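/- Let T be a caterpillar on n vertices with r pendant vertices, where 2 <= r <= floor(n/2), such that each vertex of T is adjacent to at most one pendant vertex. Then s(T) <= s(C_n(ceil(r/2), floor(r/2))), with equality if and only if T is isomorphic to C_n(ceil(r/2), floor(r/2)). -/

import Mathlib

open SimpleGraph

variable {V : Type*}

/-- The status of a vertex: sum of distances to all other vertices. -/
noncomputable def status [Fintype V] (G : SimpleGraph V) (u : V) : ℕ :=
  ∑ v : V, G.dist u v

/-- The minimum status of a graph. -/
noncomputable def minStatus [Fintype V] (G : SimpleGraph V) : ℕ :=
  sInf (Set.range (status G))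

/-- The matching number: maximum cardinality of a matching. -/
noncomputable def matchingNumber (G : SimpleGraph V) : ℕ :=
  sSup {k | ∃ M : G.Subgraph, M.IsMatching ∧ M.edgeSet.ncard = k}

/-- The domination number: minimum cardinality of a dominating set. -/
noncomputable def domNumber (G : SimpleGraph V) : ℕ :=
  sInf {k | ∃ S : Set V, (∀ v ∉ S, ∃ u ∈ S, G.Adj u v) ∧ S.ncard = k}

/-- The dumbbell `D_n(p,q)`: a path on `n - p - q` vertices `0, …, n-p-q-1`,
with `p` pendant vertices attached to vertex `0` and `q` pendant vertices
attached to vertex `n-p-q-1`. -/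
def dumbbell (n p q : ℕ) : SimpleGraph (Fin n) :=
  SimpleGraph.fromRel (fun a b =>
    ((a : ℕ) + 1 = (b : ℕ) ∧ (b : ℕ) < n - p - q) ∨
    ((a : ℕ) = 0 ∧ n - p - q ≤ (b : ℕ) ∧ (b : ℕ) < n - q) ∨
    ((a : ℕ) = n - p - q - 1 ∧ n - q ≤ (b : ℕ)))

/-- The tree `A_{n,m}`: a star with center `0` and leaves `1, …, n-m`, with one
pendant vertex `n-m+i` attached to leaf `i` for each `i = 1, …, m-1`. -/
def treeA (n m : ℕ) : SimpleGraph (Fin n) :=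
  SimpleGraph.fromRel (fun a b =>
    ((a : ℕ) = 0 ∧ 1 ≤ (b : ℕ) ∧ (b : ℕ) ≤ n - m) ∨
    (1 ≤ (a : ℕ) ∧ (a : ℕ) ≤ m - 1 ∧ (b : ℕ) = n - m + (a : ℕ)))

/-- The caterpillar `C_n(p,q)`: a path on vertices `0, …, n-p-q-1`; pendant
vertex `n-p-q+j` is attached to path vertex `j` for `j = 0, …, p-1`, and pendant
vertex `n-q+j` is attached to path vertex `n-p-2q+j` for `j = 0, …, q-1`. -/
def caterpillar (n p q : ℕ) : SimpleGraph (Fin n) :=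
  SimpleGraph.fromRel (fun a b =>
    ((a : ℕ) + 1 = (b : ℕ) ∧ (b : ℕ) < n - p - q) ∨
    (n - p - q ≤ (b : ℕ) ∧ (b : ℕ) < n - q ∧ (a : ℕ) = (b : ℕ) - (n - p - q)) ∨
    (n - q ≤ (b : ℕ) ∧ (a : ℕ) = (b : ℕ) - p - q))

/-- The sum of distances from the spine vertex `i` in a comb with spine `0, …, k-1` whose teeth sit
at the positions in `S`. -/
def spineStatus (k : ℕ) (S : Finset ℕ) (i : ℕ) : ℕ :=
  ∑ j ∈ Finset.range k, Nat.dist i j + ∑ s ∈ S, (Nat.dist i s + 1)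

/-- The first `p` and the last `q` positions of `0, …, k-1`. -/
def endPositions (k p q : ℕ) : Finset ℕ := Finset.range p ∪ Finset.Ico (k - q) k

lemma mem_endPositions {k p q s : ℕ} :
    s ∈ endPositions k p q ↔ s < p ∨ (k - q ≤ s ∧ s < k) := by
  simp [endPositions]

lemma endPositions_subset {k p q : ℕ} (hpk : p ≤ k) : endPositions k p q ⊆ Finset.range k := by
  intro s hs
  rw [mem_endPositions] at hs
  rw [Finset.mem_range]
  omega

lemma card_endPositions {k p q : ℕ} (hpq : p + q ≤ k) : (endPositions k p q).card = p + q := by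
  rw [endPositions, Finset.card_union_of_disjoint, Finset.card_range, Nat.card_Ico]
  · omega
  · rw [Finset.disjoint_left]
    intro s hs hs'
    rw [Finset.mem_range] at hs
    rw [Finset.mem_Ico] at hs'
    omega

lemma spineStatus_centers (k : ℕ) (S : Finset ℕ) (hS : S ⊆ Finset.range k) :
    spineStatus k S ((k - 1) / 2) + spineStatus k S (k / 2) =
      ∑ j ∈ Finset.range k, Nat.dist (2 * j) (k - 1) + ∑ s ∈ S, Nat.dist (2 * s) (k - 1) +
        2 * S.card := by
  have hdist : ∀ j ∈ Finset.range k,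
      Nat.dist ((k - 1) / 2) j + Nat.dist (k / 2) j = Nat.dist (2 * j) (k - 1) := by
    intro j hj
    rw [Finset.mem_range] at hj
    simp only [Nat.dist]
    omega
  have hrange := Finset.sum_congr rfl hdist
  have hteeth := Finset.sum_congr rfl fun s hs => hdist s (hS hs)
  simp only [Finset.sum_add_distrib, spineStatus, Finset.sum_const, smul_eq_mul] at *
  omega

lemma sum_dist_le_endPositions {k r : ℕ} (hrk : r ≤ k) {S : Finset ℕ}
    (hS : S ⊆ Finset.range k) (hcard : S.card = r) :
    ∑ s ∈ S, Nat.dist (2 * s) (k - 1) ≤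
        ∑ s ∈ endPositions k ((r + 1) / 2) (r / 2), Nat.dist (2 * s) (k - 1) ∧
      (∑ s ∈ S, Nat.dist (2 * s) (k - 1) =
        ∑ s ∈ endPositions k ((r + 1) / 2) (r / 2), Nat.dist (2 * s) (k - 1) →
        S = endPositions k ((r + 1) / 2) (r / 2) ∨
        S = (endPositions k ((r + 1) / 2) (r / 2)).image (fun s => k - 1 - s)) := by
  set q := r / 2 with hq
  set p := (r + 1) / 2 with hp
  set Q := endPositions k q q with hQ
  set u : ℕ → ℤ := fun s => (Nat.dist (2 * s) (k - 1) : ℤ) - ((k : ℤ) - 1 - 2 * q) with hu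
  have hu_pos : ∀ s ∈ Q, 0 < u s := by
    intro s hs
    rw [hQ, mem_endPositions] at hs
    simp only [hu, Nat.dist]
    omega
  have hu_nonpos : ∀ s < k, s ∉ Q → u s ≤ 0 := by
    intro s hsk hs
    rw [hQ, mem_endPositions] at hs
    simp only [hu, Nat.dist]
    omega
  have hsum : ∀ A : Finset ℕ, ∑ s ∈ A, u s =
      ((∑ s ∈ A, Nat.dist (2 * s) (k - 1) : ℕ) : ℤ) - A.card * ((k : ℤ) - 1 - 2 * q) := by
    intro A
    simp [hu, Finset.sum_sub_distrib]
    ring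
  have hcardE : (endPositions k p q).card = r := by
    rw [card_endPositions] <;> omega
  have hQE : ∑ s ∈ endPositions k p q, u s = ∑ s ∈ Q, u s := by
    symm
    apply Finset.sum_subset
    · intro s hs
      rw [hQ, mem_endPositions] at hs
      rw [mem_endPositions]
      omega
    · intro s hs hs'
      rw [hQ, mem_endPositions] at hs'
      rw [mem_endPositions] at hs
      simp only [hu, Nat.dist]
      omega
  have hsplitS : ∑ s ∈ S ∩ Q, u s + ∑ s ∈ S \ Q, u s = ∑ s ∈ S, u s :=
    Finset.sum_inter_add_sum_sdiff S Q u
  have hsplitQ : ∑ s ∈ Q ∩ S, u s + ∑ s ∈ Q \ S, u s = ∑ s ∈ Q, u s :=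
    Finset.sum_inter_add_sum_sdiff Q S u
  rw [Finset.inter_comm] at hsplitQ
  have hnonpos : ∀ s ∈ S \ Q, u s ≤ 0 := by
    intro s hs
    rw [Finset.mem_sdiff] at hs
    exact hu_nonpos s (Finset.mem_range.1 (hS hs.1)) hs.2
  have hpos : ∀ s ∈ Q \ S, 0 < u s := fun s hs => hu_pos s (Finset.mem_sdiff.1 hs).1
  have hle₁ := Finset.sum_nonpos hnonpos
  have hle₂ := Finset.sum_nonneg fun s hs => (hpos s hs).le
  have hS' := hsum S
  have hE' := hsum (endPositions k p q)
  rw [hcard] at hS'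
  rw [hcardE] at hE'
  refine ⟨by omega, fun heq => ?_⟩
  have hzero₁ : ∑ s ∈ S \ Q, u s = 0 := by omega
  have hzero₂ : ∑ s ∈ Q \ S, u s = 0 := by omega
  have hQS : Q ⊆ S := by
    rw [← Finset.sdiff_eq_empty_iff_subset]
    by_contra hne
    exact (Finset.sum_pos hpos (Finset.nonempty_iff_ne_empty.2 hne)).ne' hzero₂
  have hcardQ : Q.card = q + q := card_endPositions (by omega)
  rw [Finset.sum_eq_zero_iff_of_nonpos hnonpos] at hzero₁
  have hcardd : (S \ Q).card = r - (q + q) := by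
    rw [Finset.card_sdiff_of_subset hQS, hcard, hcardQ]
  rcases Nat.even_or_odd' r with ⟨m, hm | hm⟩
  · left
    have hpq : p = q := by omega
    rw [hpq]
    exact (Finset.eq_of_subset_of_card_le hQS (by omega)).symm
  · have hone : (S \ Q).card = 1 := by omega
    obtain ⟨x, hx⟩ := Finset.card_eq_one.1 hone
    have hxd : x ∈ S \ Q := by simp [hx]
    have hxu := hzero₁ x hxd
    have hxk := Finset.mem_range.1 (hS (Finset.mem_sdiff.1 hxd).1)
    have hmem : ∀ s, s ∈ S ↔ (s < q ∨ (k - q ≤ s ∧ s < k)) ∨ s = x := by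
      intro s
      rw [← Finset.union_sdiff_of_subset hQS, hx, Finset.mem_union, hQ, mem_endPositions,
        Finset.mem_singleton]
    have hx_cases : x = q ∨ x = k - 1 - q := by
      simp only [hu, Nat.dist] at hxu
      omega
    rcases hx_cases with h | h
    · left
      ext s
      rw [hmem, mem_endPositions]
      omega
    · right
      ext s
      simp only [hmem, mem_endPositions, Finset.mem_image]
      constructor
      · intro hs
        exact ⟨k - 1 - s, by omega, by omega⟩
      · rintro ⟨t, ht, rfl⟩
        omega

lemma spineStatus_centers_le {k r : ℕ} (hrk : r ≤ k) (hk : 0 < k) {i : ℕ} (hi : i < k) :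
    spineStatus k (endPositions k ((r + 1) / 2) (r / 2)) ((k - 1) / 2) +
        spineStatus k (endPositions k ((r + 1) / 2) (r / 2)) (k / 2) ≤
      2 * spineStatus k (endPositions k ((r + 1) / 2) (r / 2)) i + 1 := by
  set q := r / 2 with hq
  set p := (r + 1) / 2 with hp
  have hcard : (endPositions k p q).card = p + q := card_endPositions (by omega)
  rw [spineStatus_centers k _ (endPositions_subset (by omega))]
  simp only [spineStatus, Finset.sum_add_distrib, Finset.sum_const, smul_eq_mul]
  have htri : ∀ j < k, Nat.dist (2 * j) (k - 1) ≤ Nat.dist i j + Nat.dist i (k - 1 - j) := by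
    intro j hj
    simp only [Nat.dist]
    omega
  have hreflect : ∑ j ∈ Finset.range k, Nat.dist i (k - 1 - j) =
      ∑ j ∈ Finset.range k, Nat.dist i j := Finset.sum_range_reflect _ k
  have hcenter : (k - 1) / 2 ∈ Finset.range k := by
    rw [Finset.mem_range]
    omega
  have hspine : ∑ j ∈ Finset.range k, Nat.dist (2 * j) (k - 1) +
      (Nat.dist i ((k - 1) / 2) + Nat.dist i (k / 2) - (k - 1) % 2) ≤
      2 * ∑ j ∈ Finset.range k, Nat.dist i j := by
    have hrest : ∑ j ∈ (Finset.range k).erase ((k - 1) / 2), Nat.dist (2 * j) (k - 1) ≤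
        ∑ j ∈ (Finset.range k).erase ((k - 1) / 2), (Nat.dist i j + Nat.dist i (k - 1 - j)) :=
      Finset.sum_le_sum fun j hj =>
        htri j (Finset.mem_range.1 (Finset.mem_of_mem_erase hj))
    have h₁ := Finset.sum_erase_add (Finset.range k) (fun j => Nat.dist (2 * j) (k - 1)) hcenter
    have h₂ := Finset.sum_erase_add (Finset.range k)
      (fun j => Nat.dist i j + Nat.dist i (k - 1 - j)) hcenter
    have hsub : k - 1 - (k - 1) / 2 = k / 2 := by omega
    have hw : Nat.dist (2 * ((k - 1) / 2)) (k - 1) = (k - 1) % 2 := by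
      simp only [Nat.dist]
      omega
    have hge : (k - 1) % 2 ≤ Nat.dist i ((k - 1) / 2) + Nat.dist i (k / 2) := by
      simp only [Nat.dist]
      omega
    simp only [hsub, hw] at h₁ h₂
    rw [Finset.sum_add_distrib (s := Finset.range k), hreflect] at h₂
    omega
  have hends : ∑ s ∈ endPositions k q q, Nat.dist (2 * s) (k - 1) ≤
      2 * ∑ s ∈ endPositions k q q, Nat.dist i s := by
    have hsymm : ∑ s ∈ endPositions k q q, Nat.dist i (k - 1 - s) =
        ∑ s ∈ endPositions k q q, Nat.dist i s := by
      refine Finset.sum_nbij' (fun s => k - 1 - s) (fun s => k - 1 - s) ?_ ?_ ?_ ?_ ?_ <;>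
        intro s hs <;> rw [mem_endPositions] at hs
      · rw [mem_endPositions]
        omega
      · rw [mem_endPositions]
        omega
      · omega
      · omega
    calc _ ≤ ∑ s ∈ endPositions k q q, (Nat.dist i s + Nat.dist i (k - 1 - s)) :=
          Finset.sum_le_sum fun s hs => htri s (by rw [mem_endPositions] at hs; omega)
      _ = _ := by rw [Finset.sum_add_distrib, hsymm, two_mul]
  rcases Nat.even_or_odd' r with ⟨m, hm | hm⟩
  · have hpq : p = q := by omega
    rw [hpq]
    omega
  · have hins : endPositions k p q = insert q (endPositions k q q) := by
      ext s
      rw [Finset.mem_insert, mem_endPositions, mem_endPositions]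
      omega
    have hnot : q ∉ endPositions k q q := by
      rw [mem_endPositions]
      omega
    rw [hins, Finset.sum_insert hnot, Finset.sum_insert hnot]
    have hextra : Nat.dist (2 * q) (k - 1) ≤
        (Nat.dist i ((k - 1) / 2) + Nat.dist i (k / 2) - (k - 1) % 2) + 2 * Nat.dist i q + 1 := by
      have hl := Nat.dist.triangle_inequality q i ((k - 1) / 2)
      have hr := Nat.dist.triangle_inequality q i (k / 2)
      have hsum : Nat.dist (2 * q) (k - 1) = Nat.dist q ((k - 1) / 2) + Nat.dist q (k / 2) := by
        simp only [Nat.dist]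
        omega
      rw [Nat.dist_comm q i] at hl hr
      omega
    omega

/-- Among the combs with `r` teeth and spine `0, …, k-1`, those whose teeth are split evenly
between the two ends uniquely maximize the minimum spine status. -/
lemma spineStatus_extremal {k r i₀ i₁ : ℕ} (hrk : r ≤ k) (hk : 0 < k) {S : Finset ℕ}
    (hS : S ⊆ Finset.range k) (hcard : S.card = r)
    (hi₀ : ∀ i < k, spineStatus k S i₀ ≤ spineStatus k S i) (hi₁ : i₁ < k) :
    spineStatus k S i₀ ≤ spineStatus k (endPositions k ((r + 1) / 2) (r / 2)) i₁ ∧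
      (spineStatus k S i₀ = spineStatus k (endPositions k ((r + 1) / 2) (r / 2)) i₁ →
        S = endPositions k ((r + 1) / 2) (r / 2) ∨
        S = (endPositions k ((r + 1) / 2) (r / 2)).image (fun s => k - 1 - s)) := by
  have hle := spineStatus_centers_le hrk hk hi₁
  have hE : (endPositions k ((r + 1) / 2) (r / 2)) ⊆ Finset.range k :=
    endPositions_subset (by omega)
  have hcardE : (endPositions k ((r + 1) / 2) (r / 2)).card = r := by
    rw [card_endPositions] <;> omega
  rw [spineStatus_centers k _ hE, hcardE] at hle
  have hc := spineStatus_centers k S hS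
  have hl := hi₀ ((k - 1) / 2) (by omega)
  have hr := hi₀ (k / 2) (by omega)
  obtain ⟨hsum, hext⟩ := sum_dist_le_endPositions hrk hS hcard
  have hparity : ∀ A ⊆ Finset.range k,
      (∑ s ∈ A, Nat.dist (2 * s) (k - 1)) % 2 = (A.card * (k - 1)) % 2 := by
    intro A hA
    rw [← smul_eq_mul, ← Finset.sum_const, Finset.sum_nat_mod,
      Finset.sum_nat_mod A 2 (fun _ => k - 1)]
    congr 1
    refine Finset.sum_congr rfl fun s hs => ?_
    have := Finset.mem_range.1 (hA hs)
    simp only [Nat.dist]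
    omega
  have hpS := hparity S hS
  have hpE := hparity _ hE
  rw [hcard] at hpS hc
  rw [hcardE] at hpE
  exact ⟨by omega, fun heq => hext (by omega)⟩

section General

variable {W : Type*}

/-- A function that vanishes at `x`, changes by at most one along edges and decreases along some
edge at every other vertex is the distance from `x`. -/
lemma dist_eq_of_level {G : SimpleGraph V} {x : V} (F : V → ℕ) (hx : F x = 0)
    (hadj : ∀ u v, G.Adj u v → F v ≤ F u + 1)
    (hstep : ∀ v, v ≠ x → ∃ u, G.Adj u v ∧ F u + 1 = F v) (v : V) : G.dist x v = F v := by
  have hwalk : ∀ m v, F v = m → ∃ w : G.Walk x v, w.length = m := by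
    intro m
    induction m with
    | zero =>
      intro v hv
      by_cases hvx : v = x
      · subst hvx
        exact ⟨.nil, rfl⟩
      · obtain ⟨u, -, hu⟩ := hstep v hvx
        omega
    | succ m ih =>
      intro v hv
      obtain ⟨u, huv, hu⟩ := hstep v (by rintro rfl; omega)
      obtain ⟨w, hw⟩ := ih u (by omega)
      exact ⟨w.concat huv, by rw [Walk.length_concat, hw]⟩
  have hlower : ∀ (a b : V) (w : G.Walk a b), F b ≤ F a + w.length := by
    intro a b w
    induction w with
    | nil => simp
    | cons h w ih =>
      have := hadj _ _ h
      rw [Walk.length_cons]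
      omega
  obtain ⟨w, hw⟩ := hwalk _ v rfl
  obtain ⟨w', hw'⟩ := w.reachable.exists_walk_length_eq_dist
  have := dist_le w
  have := hlower _ _ w'
  omega

lemma dist_iso_apply_le {G : SimpleGraph V} {H : SimpleGraph W} (hG : G.Connected) (φ : G ≃g H)
    (u v : V) : H.dist (φ u) (φ v) ≤ G.dist u v := by
  obtain ⟨w, hw⟩ := hG.exists_walk_length_eq_dist u v
  rw [← hw, ← Walk.length_map φ.toHom w]
  exact dist_le _

lemma dist_iso_apply {G : SimpleGraph V} {H : SimpleGraph W} (hG : G.Connected) (φ : G ≃g H)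
    (u v : V) : H.dist (φ u) (φ v) = G.dist u v := by
  refine le_antisymm (dist_iso_apply_le hG φ u v) ?_
  have := dist_iso_apply_le (φ.connected_iff.1 hG) φ.symm (φ u) (φ v)
  simpa using this

lemma minStatus_eq_of_iso [Fintype V] [Fintype W] {G : SimpleGraph V} {H : SimpleGraph W}
    (hG : G.Connected) (φ : G ≃g H) : minStatus G = minStatus H := by
  have hstatus : ∀ u, status H (φ u) = status G u := fun u =>
    (Fintype.sum_equiv φ.toEquiv _ _ fun v => (dist_iso_apply hG φ u v).symm).symm
  rw [minStatus, minStatus, ← φ.surjective.range_comp (status H)]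
  congr 2
  exact funext fun u => (hstatus u).symm

lemma exists_status_eq_minStatus [Fintype V] [Nonempty V] (G : SimpleGraph V) :
    ∃ u, status G u = minStatus G :=
  Nat.sInf_mem (Set.range_nonempty (status G))

lemma minStatus_le_status [Fintype V] (G : SimpleGraph V) (u : V) : minStatus G ≤ status G u :=
  Nat.sInf_le ⟨u, rfl⟩

end General

/-- Adjacency in the infinite comb: `(i, false)` is the spine vertex and `(i, true)` the tooth at
position `i`. -/
def CombAdj (x y : ℕ × Bool) : Prop :=
  (x.2 = false ∧ y.2 = false ∧ (x.1 + 1 = y.1 ∨ y.1 + 1 = x.1)) ∨ (x.1 = y.1 ∧ x.2 ≠ y.2)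

/-- Distance in the infinite comb. -/
def combDist (x y : ℕ × Bool) : ℕ :=
  if x = y then 0 else Nat.dist x.1 y.1 + x.2.toNat + y.2.toNat

/-- The vertices of the comb with spine `0, …, k-1` and teeth at the positions in `S`. -/
def combVerts (k : ℕ) (S : Finset ℕ) : Finset (ℕ × Bool) :=
  Finset.range k ×ˢ {false} ∪ S ×ˢ {true}

/-- `e` identifies `G` with the comb with spine `0, …, k-1` and teeth at the positions in `S`. -/
structure IsCombLabel (G : SimpleGraph V) (k : ℕ) (S : Finset ℕ) (e : V → ℕ × Bool) : Prop where
  subset : S ⊆ Finset.range k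
  inj : Function.Injective e
  range : Set.range e = combVerts k S
  adj : ∀ u v, G.Adj u v ↔ CombAdj (e u) (e v)

lemma spine_mem_combVerts {k : ℕ} {S : Finset ℕ} {i : ℕ} : (i, false) ∈ combVerts k S ↔ i < k := by
  simp [combVerts]

lemma tooth_mem_combVerts {k : ℕ} {S : Finset ℕ} {i : ℕ} : (i, true) ∈ combVerts k S ↔ i ∈ S := by
  simp [combVerts]

lemma sum_combVerts (k : ℕ) (S : Finset ℕ) (f : ℕ × Bool → ℕ) :
    ∑ x ∈ combVerts k S, f x =
      ∑ j ∈ Finset.range k, f (j, false) + ∑ s ∈ S, f (s, true) := by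
  rw [combVerts, Finset.sum_union, Finset.sum_product, Finset.sum_product]
  · simp
  · rw [Finset.disjoint_left]
    rintro ⟨i, b⟩ h h'
    simp only [Finset.mem_product, Finset.mem_singleton] at h h'
    exact absurd (h.2.symm.trans h'.2) (by simp)

lemma combDist_le_of_combAdj {x y z : ℕ × Bool} (h : CombAdj y z) :
    combDist x z ≤ combDist x y + 1 := by
  obtain ⟨i, a⟩ := x
  obtain ⟨j, b⟩ := y
  obtain ⟨l, c⟩ := z
  simp only [CombAdj, combDist, Nat.dist, Prod.mk.injEq] at *
  cases a <;> cases b <;> cases c <;>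
    simp only [reduceCtorEq, and_true, and_false, true_and, false_and, or_false, false_or,
      ne_eq, not_true_eq_false, not_false_eq_true, if_false, Bool.toNat_true,
      Bool.toNat_false] at * <;>
    (try split_ifs) <;> omega

namespace IsCombLabel

variable {G : SimpleGraph V} {k : ℕ} {S : Finset ℕ} {e : V → ℕ × Bool}

lemma mem (h : IsCombLabel G k S e) (v : V) : e v ∈ combVerts k S := by
  rw [← Finset.mem_coe, ← h.range]
  exact ⟨v, rfl⟩

lemma exists_eq (h : IsCombLabel G k S e) {x : ℕ × Bool} (hx : x ∈ combVerts k S) :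
    ∃ v, e v = x := by
  rw [← Finset.mem_coe, ← h.range] at hx
  exact hx

lemma pos_lt (h : IsCombLabel G k S e) (v : V) : (e v).1 < k := by
  have hv := h.mem v
  rcases hev : e v with ⟨i, b⟩
  rw [hev] at hv
  cases b
  · exact spine_mem_combVerts.1 hv
  · exact Finset.mem_range.1 (h.subset (tooth_mem_combVerts.1 hv))

lemma dist_eq (h : IsCombLabel G k S e) (x v : V) : G.dist x v = combDist (e x) (e v) := by
  refine dist_eq_of_level (fun v => combDist (e x) (e v)) (by simp [combDist])
    (fun u v huv => combDist_le_of_combAdj ((h.adj u v).1 huv)) (fun v hvx => ?_) v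
  have hne : e x ≠ e v := fun heq => hvx (h.inj heq).symm
  have hvk := h.pos_lt v
  have hxk := h.pos_lt x
  suffices hs : ∃ y ∈ combVerts k S, CombAdj y (e v) ∧ combDist (e x) y + 1 = combDist (e x) (e v) by
    obtain ⟨y, hy, hadj, hd⟩ := hs
    obtain ⟨u, rfl⟩ := h.exists_eq hy
    exact ⟨u, (h.adj u v).2 hadj, hd⟩
  rcases hev : e v with ⟨j, b⟩
  rcases hex : e x with ⟨i, a⟩
  have hxS := h.mem x
  rw [hev] at hvk
  rw [hex] at hxk hxS
  rw [hev, hex] at hne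
  dsimp only at hvk hxk
  cases b
  · rcases lt_trichotomy i j with hij | hij | hij
    · refine ⟨(j - 1, false), spine_mem_combVerts.2 (by omega), ?_, ?_⟩
      · exact .inl ⟨rfl, rfl, .inl (by dsimp only; omega)⟩
      · simp only [combDist, Nat.dist, Prod.mk.injEq]
        cases a <;> simp <;> (try split_ifs) <;> omega
    · subst hij
      cases a
      · exact absurd rfl hne
      · refine ⟨(i, true), hxS, ?_, ?_⟩ <;> simp [CombAdj, combDist]
    · refine ⟨(j + 1, false), spine_mem_combVerts.2 (by omega), ?_, ?_⟩
      · simp [CombAdj]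
      · simp only [combDist, Nat.dist, Prod.mk.injEq]
        cases a <;> simp <;> (try split_ifs) <;> omega
  · refine ⟨(j, false), spine_mem_combVerts.2 hvk, by simp [CombAdj], ?_⟩
    simp only [combDist, Nat.dist, Prod.mk.injEq, ne_eq] at *
    cases a <;>
      simp only [reduceCtorEq, and_true, and_false, if_false, Bool.toNat_true,
        Bool.toNat_false] at * <;>
      (try split_ifs) <;> omega

lemma sum_comp [Fintype V] (h : IsCombLabel G k S e) (f : ℕ × Bool → ℕ) :
    ∑ v, f (e v) = ∑ x ∈ combVerts k S, f x :=
  Finset.sum_bij (fun v _ => e v) (fun v _ => h.mem v) (fun _ _ _ _ huv => h.inj huv)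
    (fun _ hx => (h.exists_eq hx).imp fun _ hv => ⟨Finset.mem_univ _, hv⟩) fun _ _ => rfl

lemma card_eq [Fintype V] (h : IsCombLabel G k S e) : Fintype.card V = k + S.card := by
  have := h.sum_comp fun _ => 1
  rw [sum_combVerts] at this
  simpa using this

lemma status_eq [Fintype V] (h : IsCombLabel G k S e) (u : V) :
    status G u = ∑ j ∈ Finset.range k, combDist (e u) (j, false) +
      ∑ s ∈ S, combDist (e u) (s, true) := by
  rw [← sum_combVerts, ← h.sum_comp]
  exact Finset.sum_congr rfl fun v _ => h.dist_eq u v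

lemma status_spine [Fintype V] (h : IsCombLabel G k S e) {u : V} {i : ℕ} (hu : e u = (i, false)) :
    status G u = spineStatus k S i := by
  rw [h.status_eq, hu, spineStatus]
  congr 1
  · refine Finset.sum_congr rfl fun j _ => ?_
    by_cases hij : i = j
    · simp [combDist, hij]
    · simp [combDist, hij]
  · exact Finset.sum_congr rfl fun j _ => by simp [combDist]

lemma spineStatus_le_status_tooth [Fintype V] (h : IsCombLabel G k S e) {u : V} {i : ℕ}
    (hu : e u = (i, true)) : spineStatus k S i ≤ status G u := by
  have hk : 0 < k := (Nat.zero_le _).trans_lt (h.pos_lt u)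
  rw [h.status_eq, hu, spineStatus]
  have hspine : ∑ j ∈ Finset.range k, combDist (i, true) (j, false) =
      ∑ j ∈ Finset.range k, Nat.dist i j + k := by
    simp [combDist, Finset.sum_add_distrib]
  have hteeth : ∑ s ∈ S, (Nat.dist i s + 1) ≤
      ∑ s ∈ S, (combDist (i, true) (s, true) + if i = s then 1 else 0) := by
    refine Finset.sum_le_sum fun s _ => ?_
    by_cases his : i = s
    · simp [combDist, his]
    · simp [combDist, his]
  have hone : (∑ s ∈ S, if i = s then 1 else 0) ≤ 1 := by
    rw [Finset.sum_ite_eq]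
    split_ifs <;> omega
  rw [Finset.sum_add_distrib (g := fun s => if i = s then 1 else 0)] at hteeth
  omega

lemma minStatus_le_spineStatus [Fintype V] (h : IsCombLabel G k S e) {i : ℕ} (hi : i < k) :
    minStatus G ≤ spineStatus k S i := by
  obtain ⟨u, hu⟩ := h.exists_eq (spine_mem_combVerts.2 hi)
  rw [← h.status_spine hu]
  exact minStatus_le_status G u

lemma exists_minStatus_eq [Fintype V] (h : IsCombLabel G k S e) (hk : 0 < k) :
    ∃ i < k, minStatus G = spineStatus k S i := by
  obtain ⟨u₀, -⟩ := h.exists_eq (spine_mem_combVerts.2 hk)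
  have : Nonempty V := ⟨u₀⟩
  obtain ⟨u, hu⟩ := exists_status_eq_minStatus G
  have hlt := h.pos_lt u
  rcases heu : e u with ⟨i, b⟩
  rw [heu] at hlt
  refine ⟨i, hlt, ?_⟩
  cases b
  · rw [← hu, h.status_spine heu]
  · exact le_antisymm (h.minStatus_le_spineStatus hlt)
      (hu ▸ h.spineStatus_le_status_tooth heu)

lemma nonempty_iso {W : Type*} {H : SimpleGraph W} {e' : W → ℕ × Bool}
    (h : IsCombLabel G k S e) (h' : IsCombLabel H k S e') : Nonempty (G ≃g H) := by
  let φ : V ≃ W := (Equiv.ofInjective e h.inj).trans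
    ((Equiv.setCongr (h.range.trans h'.range.symm)).trans (Equiv.ofInjective e' h'.inj).symm)
  have hφ : ∀ v, e' (φ v) = e v := fun v => by
    simp only [φ, Equiv.trans_apply, Equiv.apply_ofInjective_symm]
    rfl
  exact ⟨⟨φ, fun {u v} => by rw [h'.adj, h.adj, hφ, hφ]⟩⟩

lemma reverse (h : IsCombLabel G k S e) :
    IsCombLabel G k (S.image fun s => k - 1 - s) (fun v => (k - 1 - (e v).1, (e v).2)) where
  subset := by
    intro s hs
    obtain ⟨t, ht, rfl⟩ := Finset.mem_image.1 hs
    have := Finset.mem_range.1 (h.subset ht)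
    rw [Finset.mem_range]
    omega
  inj := by
    intro u v huv
    have hu := h.pos_lt u
    have hv := h.pos_lt v
    rw [Prod.mk.injEq] at huv
    exact h.inj (Prod.ext (by omega) huv.2)
  range := by
    ext ⟨i, b⟩
    rw [Set.mem_range, Finset.mem_coe]
    constructor
    · rintro ⟨v, hv⟩
      rw [Prod.mk.injEq] at hv
      have hvk := h.pos_lt v
      have hmem := h.mem v
      rw [← Prod.mk.eta (p := e v), hv.2] at hmem
      cases b
      · rw [spine_mem_combVerts]
        omega
      · rw [tooth_mem_combVerts] at hmem ⊢
        exact Finset.mem_image.2 ⟨_, hmem, hv.1⟩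
    · intro hi
      cases b
      · rw [spine_mem_combVerts] at hi
        obtain ⟨v, hv⟩ := h.exists_eq (spine_mem_combVerts.2 (show k - 1 - i < k by omega))
        refine ⟨v, ?_⟩
        rw [hv, Prod.mk.injEq]
        exact ⟨by omega, rfl⟩
      · rw [tooth_mem_combVerts] at hi
        obtain ⟨t, ht, rfl⟩ := Finset.mem_image.1 hi
        obtain ⟨v, hv⟩ := h.exists_eq (tooth_mem_combVerts.2 ht)
        exact ⟨v, by rw [hv]⟩
  adj := by
    intro u v
    have hu := h.pos_lt u
    have hv := h.pos_lt v
    rw [h.adj, CombAdj, CombAdj]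
    dsimp only
    constructor
    · rintro (⟨h₁, h₂, h₃⟩ | ⟨h₁, h₂⟩)
      · exact .inl ⟨h₁, h₂, by omega⟩
      · exact .inr ⟨by omega, h₂⟩
    · rintro (⟨h₁, h₂, h₃⟩ | ⟨h₁, h₂⟩)
      · exact .inl ⟨h₁, h₂, by omega⟩
      · exact .inr ⟨by omega, h₂⟩

end IsCombLabel

lemma isCombLabel_caterpillar {n p q : ℕ} (hpq : 2 * (p + q) ≤ n) :
    IsCombLabel (caterpillar n p q) (n - p - q) (endPositions (n - p - q) p q)
      (fun a => if (a : ℕ) < n - p - q then ((a : ℕ), false)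
        else if (a : ℕ) < n - q then (a - (n - p - q), true) else (a - p - q, true)) where
  subset := endPositions_subset (by omega)
  inj := by
    intro a b hab
    have ha := a.2
    have hb := b.2
    dsimp only at hab
    ext
    split_ifs at hab <;> simp only [Prod.mk.injEq] at hab <;> first | omega | simp at hab
  range := by
    ext ⟨i, b⟩
    rw [Set.mem_range, Finset.mem_coe]
    constructor
    · rintro ⟨a, ha⟩
      have ha' := a.2
      split_ifs at ha <;> rw [Prod.mk.injEq] at ha <;> obtain ⟨rfl, rfl⟩ := ha
      · rw [spine_mem_combVerts]
        assumption
      · rw [tooth_mem_combVerts, mem_endPositions]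
        omega
      · rw [tooth_mem_combVerts, mem_endPositions]
        omega
    · intro hi
      cases b
      · rw [spine_mem_combVerts] at hi
        exact ⟨⟨i, by omega⟩, by simp [hi]⟩
      · rw [tooth_mem_combVerts, mem_endPositions] at hi
        by_cases hip : i < p
        · refine ⟨⟨n - p - q + i, by omega⟩, ?_⟩
          dsimp only
          rw [if_neg (by omega), if_pos (by omega), Prod.mk.injEq]
          exact ⟨by omega, rfl⟩
        · refine ⟨⟨i + p + q, by omega⟩, ?_⟩
          dsimp only
          rw [if_neg (by omega), if_neg (by omega), Prod.mk.injEq]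
          exact ⟨by omega, rfl⟩
  adj := by
    intro a b
    have ha := a.2
    have hb := b.2
    rw [caterpillar, fromRel_adj, CombAdj, ne_eq, Fin.ext_iff]
    split_ifs <;> simp <;> omega

lemma exists_isCombLabel [Fintype V] {T : SimpleGraph V} (hT : T.Connected)
    (hcard : 3 ≤ Fintype.card V) {k : ℕ}
    (φ : (T.induce {v : V | (T.neighborSet v).ncard ≠ 1}) ≃g pathGraph k)
    (hone : ∀ v : V, {u : V | T.Adj v u ∧ (T.neighborSet u).ncard = 1}.ncard ≤ 1) :
    ∃ S e, IsCombLabel T k S e ∧ S.card = {v : V | (T.neighborSet v).ncard = 1}.ncard := by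
  classical
  have hnb : ∀ v, (T.neighborSet v).ncard = 1 →
      ∃ u, T.Adj v u ∧ ∀ w, T.Adj v w → w = u := by
    intro v hv
    obtain ⟨u, hu⟩ := Set.ncard_eq_one.1 hv
    have hmem : ∀ w, T.Adj v w ↔ w = u := fun w => by
      rw [← mem_neighborSet, hu, Set.mem_singleton_iff]
    exact ⟨u, (hmem u).2 rfl, fun w => (hmem w).1⟩
  have hleaf : ∀ u v, (T.neighborSet u).ncard = 1 → T.Adj u v → (T.neighborSet v).ncard ≠ 1 := by
    intro u v hu huv hv
    obtain ⟨u', -, hu'⟩ := hnb u hu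
    obtain ⟨v', -, hv'⟩ := hnb v hv
    have hclosed : ∀ a b (w : T.Walk a b), a = u ∨ a = v → b = u ∨ b = v := by
      intro a b w
      induction w with
      | nil => exact id
      | cons hadj w ih =>
        rintro (rfl | rfl)
        · exact ih (.inr ((hu' _ hadj).trans (hu' _ huv).symm))
        · exact ih (.inl ((hv' _ hadj).trans (hv' _ huv.symm).symm))
    have hle : Fintype.card V ≤ ({u, v} : Finset V).card := by
      rw [← Finset.card_univ]
      refine Finset.card_le_card fun b _ => ?_
      obtain ⟨w⟩ := hT.preconnected u b
      simpa using hclosed u b w (.inl rfl)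
    have := Finset.card_le_two (a := u) (b := v)
    omega
  have huniq : ∀ v u₁ u₂, T.Adj v u₁ → (T.neighborSet u₁).ncard = 1 → T.Adj v u₂ →
      (T.neighborSet u₂).ncard = 1 → u₁ = u₂ := fun v u₁ u₂ h₁ h₁' h₂ h₂' =>
    (Set.ncard_le_one (Set.toFinite _)).1 (hone v) u₁ ⟨h₁, h₁'⟩ u₂ ⟨h₂, h₂'⟩
  have hsupport : ∀ v, ∃ u, (T.neighborSet u).ncard ≠ 1 ∧
      ((T.neighborSet v).ncard ≠ 1 → u = v) ∧
      ((T.neighborSet v).ncard = 1 → ∀ w, T.Adj v w ↔ w = u) := by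
    intro v
    by_cases hv : (T.neighborSet v).ncard = 1
    · obtain ⟨u, hu, hu'⟩ := hnb v hv
      exact ⟨u, hleaf v u hv hu, fun h => absurd hv h,
        fun _ w => ⟨hu' w, by rintro rfl; exact hu⟩⟩
    · exact ⟨v, hv, fun _ => rfl, fun h => absurd h hv⟩
  choose base hbase hspine htooth using hsupport
  let pos : V → ℕ := fun v => φ ⟨base v, hbase v⟩
  have hpos_inj : ∀ u v, pos u = pos v → base u = base v := fun u v huv =>
    congrArg Subtype.val (φ.injective (Fin.ext huv))
  have hpos_adj : ∀ u v, T.Adj (base u) (base v) ↔ pos u + 1 = pos v ∨ pos v + 1 = pos u := by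
    intro u v
    rw [← pathGraph_adj, φ.map_adj_iff, comap_adj]
    rfl
  have hpos_surj : ∀ i < k, ∃ v, (T.neighborSet v).ncard ≠ 1 ∧ pos v = i := by
    intro i hi
    obtain ⟨⟨v, hv⟩, hvi⟩ := φ.surjective ⟨i, hi⟩
    refine ⟨v, hv, ?_⟩
    have : (⟨base v, hbase v⟩ : {v : V | (T.neighborSet v).ncard ≠ 1}) = ⟨v, hv⟩ :=
      Subtype.ext (hspine v hv)
    simp only [pos, this, hvi]
  have htooth_adj : ∀ u v, (T.neighborSet u).ncard = 1 → (T.neighborSet v).ncard ≠ 1 →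
      (T.Adj u v ↔ pos u = pos v) := by
    intro u v hu hv
    rw [htooth u hu]
    constructor
    · intro h
      have hb : base v = base u := (hspine v hv).trans h
      simp only [pos, hb]
    · intro h
      rw [hpos_inj u v h, hspine v hv]
  let L : Finset V := Finset.univ.filter fun v => (T.neighborSet v).ncard = 1
  have hL : ∀ v, v ∈ L ↔ (T.neighborSet v).ncard = 1 := fun v => by simp [L]
  have hinjL : ∀ u v, (T.neighborSet u).ncard = 1 → (T.neighborSet v).ncard = 1 →
      pos u = pos v → u = v := by
    intro u v hu hv huv
    have hb := hpos_inj u v huv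
    exact huniq (base u) u v ((htooth u hu _).2 rfl).symm hu
      (hb ▸ ((htooth v hv _).2 rfl).symm) hv
  refine ⟨L.image pos, fun v => (pos v, decide ((T.neighborSet v).ncard = 1)), ⟨?_, ?_, ?_, ?_⟩, ?_⟩
  · intro i hi
    obtain ⟨v, -, rfl⟩ := Finset.mem_image.1 hi
    exact Finset.mem_range.2 (Fin.is_lt _)
  · intro u v huv
    rw [Prod.mk.injEq, decide_eq_decide] at huv
    by_cases hu : (T.neighborSet u).ncard = 1
    · exact hinjL u v hu (huv.2.1 hu) huv.1
    · rw [← hspine u hu, ← hspine v (fun hv => hu (huv.2.2 hv))]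
      exact hpos_inj u v huv.1
  · ext ⟨i, b⟩
    rw [Set.mem_range, Finset.mem_coe]
    cases b
    · rw [spine_mem_combVerts]
      constructor
      · rintro ⟨v, hv⟩
        rw [Prod.mk.injEq] at hv
        exact hv.1 ▸ Fin.is_lt _
      · intro hi
        obtain ⟨v, hv, hvi⟩ := hpos_surj i hi
        exact ⟨v, by simp [hv, hvi]⟩
    · rw [tooth_mem_combVerts, Finset.mem_image]
      refine exists_congr fun v => ?_
      rw [hL, Prod.mk.injEq, decide_eq_true_iff, and_comm]
  · intro u v
    simp only [CombAdj, decide_eq_false_iff_not, ne_eq, decide_eq_decide]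
    by_cases hu : (T.neighborSet u).ncard = 1 <;> by_cases hv : (T.neighborSet v).ncard = 1
    · simp only [hu, hv, not_true_eq_false, false_and, and_false, or_false, iff_false]
      exact fun huv => hleaf u v hu huv hv
    · simp only [hu, hv, not_true_eq_false, false_and, false_or, iff_false,
        not_false_eq_true, and_true]
      exact htooth_adj u v hu hv
    · rw [T.adj_comm, htooth_adj v u hv hu]
      simp [hu, hv, eq_comm]
    · rw [← hpos_adj, hspine u hu, hspine v hv]
      simp [hu, hv]
  · rw [Finset.card_image_of_injOn fun u hu v hv => hinjL u v ((hL u).1 hu) ((hL v).1 hv),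
      ← Set.ncard_coe_finset]
    congr 1
    ext v
    exact hL v

/-- Among caterpillars on `n` vertices with `r` pendant vertices in which each
vertex is adjacent to at most one pendant vertex, `C_n(⌈r/2⌉, ⌊r/2⌋)` uniquely
maximizes the minimum status. -/
theorem stmt11 [Fintype V] (T : SimpleGraph V) (n r : ℕ)
    (hn : Fintype.card V = n) (hT : T.IsTree)
    (hcat : ∃ k : ℕ,
      Nonempty ((T.induce {v : V | (T.neighborSet v).ncard ≠ 1}) ≃g pathGraph k))
    (hr : {v : V | (T.neighborSet v).ncard = 1}.ncard = r)
    (hr2 : 2 ≤ r) (hrn : 2 * r ≤ n)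
    (hone : ∀ v : V, {u : V | T.Adj v u ∧ (T.neighborSet u).ncard = 1}.ncard ≤ 1) :
    minStatus T ≤ minStatus (caterpillar n ((r + 1) / 2) (r / 2)) ∧
      (minStatus T = minStatus (caterpillar n ((r + 1) / 2) (r / 2)) ↔
        Nonempty (T ≃g caterpillar n ((r + 1) / 2) (r / 2))) := by
  obtain ⟨k, ⟨φ⟩⟩ := hcat
  obtain ⟨S, e, hlabel, hcard⟩ := exists_isCombLabel hT.connected (by omega) φ hone
  rw [hr] at hcard
  have hnk := hlabel.card_eq
  have hk : n - (r + 1) / 2 - r / 2 = k := by omega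
  have hcater := isCombLabel_caterpillar (n := n) (p := (r + 1) / 2) (q := r / 2) (by omega)
  rw [hk] at hcater
  obtain ⟨i₀, -, hi₀⟩ := hlabel.exists_minStatus_eq (by omega)
  obtain ⟨i₁, hi₁k, hi₁⟩ := hcater.exists_minStatus_eq (by omega)
  obtain ⟨hle, hext⟩ := spineStatus_extremal (by omega) (by omega) hlabel.subset hcard
    (fun i hi => hi₀ ▸ hlabel.minStatus_le_spineStatus hi) hi₁k
  rw [← hi₀, ← hi₁] at hle hext
  refine ⟨hle, fun heq => ?_, fun ⟨ψ⟩ => minStatus_eq_of_iso hT.connected ψ⟩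
  rcases hext heq with hS | hS
  · subst hS
    exact hlabel.nonempty_iso hcater
  · subst hS
    exact hlabel.nonempty_iso hcater.reverse
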